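/- Let 𝒜 be an abelian category, 𝒳 a full subcategory closed under extensions and cokernels of monomorphisms and containing a generator subcategory 𝒲 with Extⁱ(𝒲, 𝒳) = 0 for i ≥ 1. If 0 → C → X₀ → ⋯ → X₋ₙ₊₁ → U → 0 is exact with all X₋ᵢ ∈ 𝒳, C has a finite 𝒳-coresolution, and Extⁱ(W, U) = 0 for all W ∈ 𝒲 and i ≥ 1, then U ∈ 𝒳. -/

import Mathlib

open CategoryTheory CategoryTheory.Limits Opposite

universe v u

variable {A : Type u} [Category.{v} A] [Abelian A]

/-- `IsSES f g` : `0 → X → Y → Z → 0` is a short exact sequence. -/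
def IsSES {X Y Z : A} (f : X ⟶ Y) (g : Y ⟶ Z) : Prop :=
  ∃ w : f ≫ g = 0, (ShortComplex.mk f g w).ShortExact

/-- `HasCoresLE S n C` : `C` admits a coresolution `0 → C → X₀ → ⋯ → X₋ₙ → 0`
with all terms in `S`. -/
def HasCoresLE (S : Set A) : ℕ → A → Prop
  | 0, C => C ∈ S
  | n+1, C => ∃ (X K : A) (f : C ⟶ X) (g : X ⟶ K), X ∈ S ∧ IsSES f g ∧ HasCoresLE S n K

/-- `S` is closed under extensions. -/
def ExtClosed (S : Set A) : Prop :=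
  ∀ ⦃X Y Z : A⦄ (f : X ⟶ Y) (g : Y ⟶ Z), IsSES f g → X ∈ S → Z ∈ S → Y ∈ S

/-- `S` is closed under cokernels of monomorphisms. -/
def CokerClosed (S : Set A) : Prop :=
  ∀ ⦃X Y Z : A⦄ (f : X ⟶ Y) (g : Y ⟶ Z), IsSES f g → X ∈ S → Y ∈ S → Z ∈ S

/-- `S` is closed under kernels of epimorphisms. -/
def KerClosed (S : Set A) : Prop :=
  ∀ ⦃X Y Z : A⦄ (f : X ⟶ Y) (g : Y ⟶ Z), IsSES f g → Y ∈ S → Z ∈ S → X ∈ S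

/-- `W` is a generator for `X` : every object of `X` receives an epimorphism from
an object of `W` with kernel in `X`. -/
def IsGen (W X : Set A) : Prop :=
  W ⊆ X ∧ ∀ C ∈ X, ∃ (X' W₀ : A) (f : X' ⟶ W₀) (g : W₀ ⟶ C),
    W₀ ∈ W ∧ X' ∈ X ∧ IsSES f g

/-- `Extⁱ(X, Y) = 0`. -/
def ExtVanish [EnoughProjectives A] (i : ℕ) (X Y : A) : Prop :=
  IsZero (((Ext ℤ A i).obj (op X)).obj Y)

/-- `W` is `X`-projective: `Extⁱ(W, X) = 0` for all `i ≥ 1`. -/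
def IsXProj [EnoughProjectives A] (W X : Set A) : Prop :=
  ∀ W' ∈ W, ∀ X' ∈ X, ∀ i : ℕ, 1 ≤ i → ExtVanish i W' X'

/-- Exact sequences `0 → C → X₀ → ⋯ → X₋ₙ₊₁ → U → 0` with middle terms in `S`. -/
def CoresWithCokernel (S : Set A) : ℕ → A → A → Prop
  | 0, C, U => Nonempty (C ≅ U)
  | n+1, C, U => ∃ (X K : A) (f : C ⟶ X) (g : X ⟶ K),
      X ∈ S ∧ IsSES f g ∧ CoresWithCokernel S n K U


lemma ext_sub [EnoughProjectives A] [CategoryTheory.HasExt.{v} A] {X Y : A} {i : ℕ} (hi : 1 ≤ i)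
    (h : ExtVanish i X Y) : ∀ e : Abelian.Ext X Y i, e = 0 := by
  obtain ⟨k, rfl⟩ : ∃ k, i = k + 1 := ⟨i - 1, by omega⟩
  intro e
  let R := projectiveResolution X
  obtain ⟨f, hf, rfl⟩ := R.extMk_surjective e (k + 2) rfl
  rw [R.extMk_eq_zero_iff f (k + 2) rfl hf k rfl]
  have h2 : IsZero ((R.complex.linearYonedaObj ℤ Y).homology (k + 1)) :=
    IsZero.of_iso h (R.isoExt (k + 1) Y).symm
  rw [← HomologicalComplex.exactAt_iff_isZero_homology,
    HomologicalComplex.exactAt_iff' _ k (k + 1) (k + 2) (by simp) (by simp),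
    ShortComplex.moduleCat_exact_iff] at h2
  exact h2 f hf

lemma ses_of {X Y Z : A} {f : X ⟶ Y} {g : Y ⟶ Z} (w : f ≫ g = 0) [Mono f] [Epi g]
    (h : ∀ (T : A) (t : T ⟶ Y), t ≫ g = 0 → ∃ s, s ≫ f = t) : IsSES f g := by
  refine ⟨w, ShortComplex.ShortExact.mk' ?_ ‹_› ‹_›⟩
  refine ShortComplex.exact_of_f_is_kernel _ (KernelFork.IsLimit.ofι' _ _ ?_)
  intro T t ht
  exact ⟨(h T t ht).choose, (h T t ht).choose_spec⟩

lemma IsSES.mono {X Y Z : A} {f : X ⟶ Y} {g : Y ⟶ Z} (h : IsSES f g) : Mono f :=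
  h.2.mono_f

lemma IsSES.epi {X Y Z : A} {f : X ⟶ Y} {g : Y ⟶ Z} (h : IsSES f g) : Epi g :=
  h.2.epi_g

lemma IsSES.lift {X Y Z : A} {f : X ⟶ Y} {g : Y ⟶ Z} (h : IsSES f g) {T : A} (t : T ⟶ Y)
    (ht : t ≫ g = 0) : ∃ s, s ≫ f = t := by
  obtain ⟨w, h⟩ := h
  exact ⟨KernelFork.IsLimit.lift' h.fIsKernel t ht |>.1,
    (KernelFork.IsLimit.lift' h.fIsKernel t ht).2⟩

lemma IsSES.toOp {X Y Z : A} {f : X ⟶ Y} {g : Y ⟶ Z} (h : IsSES f g) : IsSES g.op f.op :=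
  ⟨by rw [← op_comp, h.1, op_zero], h.2.op⟩

lemma IsSES.toUnop {X Y Z : Aᵒᵖ} {f : X ⟶ Y} {g : Y ⟶ Z} (h : IsSES f g) :
    IsSES g.unop f.unop :=
  ⟨by rw [← unop_comp, h.1, unop_zero], h.2.unop⟩

/-- Pullback of a short exact sequence. -/
lemma ses_pullback {X Y Z T : A} {f : X ⟶ Y} {g : Y ⟶ Z} (h : IsSES f g) (k : T ⟶ Z) :
    IsSES (pullback.lift f 0 (by rw [h.1, zero_comp]) : X ⟶ pullback g k)
      (pullback.snd g k) := by
  have := h.mono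
  have := h.epi
  have : Mono (pullback.lift f 0 (by rw [h.1, zero_comp]) : X ⟶ pullback g k) :=
    mono_of_mono_fac (pullback.lift_fst _ _ _)
  refine ses_of (pullback.lift_snd _ _ _) ?_
  intro S t ht
  obtain ⟨s, hs⟩ := h.lift (t ≫ pullback.fst g k) (by
    rw [Category.assoc, pullback.condition, reassoc_of% ht, zero_comp])
  refine ⟨s, ?_⟩
  apply pullback.hom_ext
  · rw [Category.assoc, pullback.lift_fst, hs]
  · rw [Category.assoc, pullback.lift_snd, ht, comp_zero]

lemma ses_pullback' {X Y Z T : A} {f : X ⟶ Y} {g : Y ⟶ Z} (h : IsSES f g) (k : T ⟶ Z) :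
    IsSES (pullback.lift 0 f (by rw [h.1, zero_comp]) : X ⟶ pullback k g)
      (pullback.fst k g) := by
  have := h.mono
  have := h.epi
  have : Mono (pullback.lift 0 f (by rw [h.1, zero_comp]) : X ⟶ pullback k g) :=
    mono_of_mono_fac (pullback.lift_snd _ _ _)
  refine ses_of (pullback.lift_fst _ _ _) ?_
  intro S t ht
  obtain ⟨s, hs⟩ := h.lift (t ≫ pullback.snd k g) (by
    rw [Category.assoc, ← pullback.condition, reassoc_of% ht, zero_comp])
  refine ⟨s, ?_⟩
  apply pullback.hom_ext
  · rw [Category.assoc, pullback.lift_fst, ht, comp_zero]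
  · rw [Category.assoc, pullback.lift_snd, hs]

lemma ses_pb {X₁ Y₁ X₂ Y₂ Z : A} {f₁ : X₁ ⟶ Y₁} {g₁ : Y₁ ⟶ Z} {f₂ : X₂ ⟶ Y₂} {g₂ : Y₂ ⟶ Z}
    (h₁ : IsSES f₁ g₁) (h₂ : IsSES f₂ g₂) :
    ∃ (E : A) (i₁ : X₁ ⟶ E) (p₂ : E ⟶ Y₂) (i₂ : X₂ ⟶ E) (p₁ : E ⟶ Y₁),
      IsSES i₁ p₂ ∧ IsSES i₂ p₁ :=
  ⟨_, _, _, _, _, ses_pullback h₁ g₂, ses_pullback' h₂ g₁⟩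

lemma ses_po {X₁ Y₁ X₂ Y₂ Z : A} {f₁ : Z ⟶ Y₁} {g₁ : Y₁ ⟶ X₁} {f₂ : Z ⟶ Y₂} {g₂ : Y₂ ⟶ X₂}
    (h₁ : IsSES f₁ g₁) (h₂ : IsSES f₂ g₂) :
    ∃ (E : A) (i₁ : Y₂ ⟶ E) (p₁ : E ⟶ X₁) (i₂ : Y₁ ⟶ E) (p₂ : E ⟶ X₂),
      IsSES i₁ p₁ ∧ IsSES i₂ p₂ := by
  obtain ⟨E, a, b, c, d, h, h'⟩ := ses_pb h₁.toOp h₂.toOp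
  exact ⟨_, _, _, _, _, h.toUnop, h'.toUnop⟩

lemma ses_comp {X W E L Y : A} {a : X ⟶ W} {w : W ⟶ E} {i : L ⟶ E} {p : E ⟶ Y}
    (h₁ : IsSES a w) (h₂ : IsSES i p) :
    ∃ (K : A) (j : K ⟶ W) (q : W ⟶ Y) (k : X ⟶ K) (l : K ⟶ L),
      IsSES j q ∧ IsSES k l := by
  have := h₁.epi
  have := h₂.epi
  have := h₂.mono
  refine ⟨_, pullback.fst w i, w ≫ p, _, _, ?_, ses_pullback h₁ i⟩
  have : Epi (w ≫ p) := epi_comp _ _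
  refine ses_of ?_ ?_
  · rw [pullback.condition_assoc, h₂.1, comp_zero]
  · intro T t ht
    obtain ⟨s, hs⟩ := h₂.lift (t ≫ w) (by simpa using ht)
    exact ⟨pullback.lift t s hs.symm, pullback.lift_fst _ _ _⟩

lemma ses_comp' {X W E L Y : A} {a : W ⟶ X} {w : E ⟶ W} {i : E ⟶ L} {p : Y ⟶ E}
    (h₁ : IsSES w a) (h₂ : IsSES p i) :
    ∃ (K : A) (q : Y ⟶ W) (j : W ⟶ K) (l : L ⟶ K) (k : K ⟶ X),
      IsSES q j ∧ IsSES l k := by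
  obtain ⟨E, a, b, c, d, h, h'⟩ := ses_comp h₁.toOp h₂.toOp
  exact ⟨_, _, _, _, _, h.toUnop, h'.toUnop⟩

/-- Lemma B. -/
lemma cores_coker {𝒳 : Set A} (hcoker : CokerClosed 𝒳) {m : ℕ} {X Q P : A} {f : X ⟶ Q} {g : Q ⟶ P}
    (h : IsSES f g) (hx : X ∈ 𝒳) (hQ : HasCoresLE 𝒳 m Q) : HasCoresLE 𝒳 m P := by
  cases m with
  | zero => exact hcoker f g h hx hQ
  | succ m =>
    obtain ⟨Z, M, a, b, hZ, hab, hM⟩ := hQ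
    obtain ⟨K, q, j, l, k, h1, h2⟩ := ses_comp' hab h
    exact ⟨K, M, l, k, hcoker _ _ h1 hx hZ, h2, hM⟩

/-- Lemma A. -/
lemma cores_approx {𝒳 𝒲 : Set A} (hX : ExtClosed 𝒳) (hgen : IsGen 𝒲 𝒳) (m : ℕ) :
    ∀ L : A, HasCoresLE 𝒳 m L → ∃ (X Y : A) (f : X ⟶ Y) (g : Y ⟶ L),
      X ∈ 𝒳 ∧ HasCoresLE 𝒲 m Y ∧ IsSES f g := by
  induction m with
  | zero =>
    intro L hL
    obtain ⟨X, W, f, g, hW, hX, h⟩ := hgen.2 L hL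
    exact ⟨X, W, f, g, hX, hW, h⟩
  | succ m ih =>
    rintro L ⟨Z, M, a, b, hZ, hab, hM⟩
    obtain ⟨X, Y, f, g, hx, hY, hfg⟩ := ih M hM
    obtain ⟨E, i₁, p₂, i₂, p₁, h1, h2⟩ := ses_pb hab hfg
    have hE : E ∈ 𝒳 := hX _ _ h2 hx hZ
    obtain ⟨X', W, a', w, hW, hX', haw⟩ := hgen.2 E hE
    obtain ⟨K, j, q, k, l, h3, h4⟩ := ses_comp haw h1
    exact ⟨X', K, k, l, hX', ⟨W, Y, j, q, hW, h3, hY⟩, h4⟩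

lemma ses_split [CategoryTheory.HasExt.{v} A] {X Y Z : A} {f : X ⟶ Y} {g : Y ⟶ Z}
    (h : IsSES f g) (he : ∀ e : Abelian.Ext Z X 1, e = 0) :
    ∃ (r : Y ⟶ X) (s : Z ⟶ Y), f ≫ r = 𝟙 X ∧ s ≫ g = 𝟙 Z ∧ s ≫ r = 0 ∧ r ≫ f + g ≫ s = 𝟙 Y := by
  obtain ⟨w, h⟩ := h
  obtain ⟨x, hx⟩ := Abelian.Ext.covariant_sequence_exact₃ Z h (Abelian.Ext.mk₀ (𝟙 Z))
    (zero_add 1) (he _)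
  obtain ⟨s, rfl⟩ := Abelian.Ext.homEquiv₀.symm.surjective x
  have hs : s ≫ g = 𝟙 Z := by
    apply Abelian.Ext.homEquiv₀.symm.injective
    simpa using hx
  have := h.mono_f
  let σ := ShortComplex.Splitting.ofExactOfSection _ h.exact s hs h.mono_f
  exact ⟨σ.r, σ.s, σ.f_r, σ.s_g, σ.s_r, σ.id⟩

lemma ext_wcores [EnoughProjectives A] [CategoryTheory.HasExt.{v} A] {𝒳 𝒲 : Set A}
    (hproj : IsXProj 𝒲 𝒳) (m : ℕ) : ∀ Y : A, HasCoresLE 𝒲 m Y → ∀ X ∈ 𝒳, ∀ i : ℕ, 1 ≤ i →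
      ∀ e : Abelian.Ext Y X i, e = 0 := by
  induction m with
  | zero => exact fun Y hY X hX i hi => ext_sub hi (hproj Y hY X hX i hi)
  | succ m ih =>
    rintro Y ⟨W, K, f, g, hW, ⟨w, h⟩, hK⟩ X hX i hi e
    obtain ⟨x, rfl⟩ := Abelian.Ext.contravariant_sequence_exact₁ h X e rfl
      (ih K hK X hX _ (by omega) _)
    rw [ext_sub hi (hproj W hW X hX i hi) x]
    simp

lemma cores_sum [EnoughProjectives A] [CategoryTheory.HasExt.{v} A] {𝒳 𝒲 : Set A}
    (hX : ExtClosed 𝒳) (hWX : 𝒲 ⊆ 𝒳) (hproj : IsXProj 𝒲 𝒳) (m : ℕ) {X Q Y : A}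
    {i : X ⟶ Q} {p : Q ⟶ Y} (h : IsSES i p) (hx : X ∈ 𝒳) (hY : HasCoresLE 𝒲 m Y) :
    HasCoresLE 𝒳 m Q := by
  obtain ⟨r, s, h1, h2, h3, h4⟩ := ses_split h (ext_wcores hproj m Y hY X hx 1 le_rfl)
  cases m with
  | zero => exact hX _ _ h hx (hWX hY)
  | succ m =>
    have hmono : ∀ (n : ℕ) (K : A), HasCoresLE 𝒲 n K → HasCoresLE 𝒳 n K := by
      intro n
      induction n with
      | zero => exact fun K hK => hWX hK
      | succ n ih =>
        rintro K ⟨W, K', f, g, hW, hfg, hK⟩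
        exact ⟨W, K', f, g, hWX hW, hfg, ih _ hK⟩
    obtain ⟨W, K, f, g, hW, hfg, hK⟩ := hY
    have := hfg.mono
    have := hfg.epi
    have hsum : IsSES (biprod.inl : X ⟶ X ⊞ W) biprod.snd := by
      refine ses_of (by simp) fun T t ht => ⟨t ≫ biprod.fst, ?_⟩
      apply biprod.hom_ext <;> simp [ht]
    refine ⟨X ⊞ W, K, biprod.lift r (p ≫ f), biprod.snd ≫ g, hX _ _ hsum hx (hWX hW), ?_,
      hmono m K hK⟩
    have hm : Mono (biprod.lift r (p ≫ f)) := by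
      refine Preadditive.mono_of_cancel_zero _ fun t ht => ?_
      have ha : t ≫ r = 0 := by simpa using ht =≫ biprod.fst
      have hb : t ≫ p = 0 := by
        rw [← cancel_mono f]; simpa using ht =≫ biprod.snd
      rw [← Category.comp_id t, ← h4, Preadditive.comp_add, reassoc_of% ha, reassoc_of% hb]
      simp
    have he : Epi ((biprod.snd : X ⊞ W ⟶ W) ≫ g) := epi_comp _ _
    refine ses_of (by simp [hfg.1]) fun T t ht => ?_
    obtain ⟨u, hu⟩ := hfg.lift (t ≫ biprod.snd) (by simpa using ht)
    refine ⟨t ≫ biprod.fst ≫ i + u ≫ s, ?_⟩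
    apply biprod.hom_ext
    · simp [h1, h3]
    · simp [reassoc_of% h.1, reassoc_of% h2, hu]

lemma cores_step [EnoughProjectives A] [CategoryTheory.HasExt.{v} A] {𝒳 𝒲 : Set A}
    (hX : ExtClosed 𝒳) (hcoker : CokerClosed 𝒳)
    (hgen : IsGen 𝒲 𝒳) (hproj : IsXProj 𝒲 𝒳) (m : ℕ) {C X K : A} {f : C ⟶ X} {g : X ⟶ K}
    (h : IsSES f g) (hx : X ∈ 𝒳) (hC : HasCoresLE 𝒳 m C) : ∃ m, HasCoresLE 𝒳 m K := by
  cases m with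
  | zero => exact ⟨0, hcoker _ _ h hC hx⟩
  | succ m =>
    obtain ⟨Y, L, a, b, hY, hab, hL⟩ := hC
    obtain ⟨P, i₁, p₁, i₂, p₂, h1, h2⟩ := ses_po h hab
    obtain ⟨X', Y', f', g', hX', hY', h'⟩ := cores_approx hX hgen m L hL
    obtain ⟨Q, j₁, q₂, j₂, q₁, h3, h4⟩ := ses_pb h2 h'
    have hQ := cores_sum hX hgen.1 hproj m h3 hx hY'
    have hP := cores_coker hcoker h4 hX' hQ
    exact ⟨m, cores_coker hcoker h1 hY hP⟩

lemma mem_of_cores [CategoryTheory.HasExt.{v} A] {𝒳 𝒲 : Set A}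
    (hX : ExtClosed 𝒳) (hcoker : CokerClosed 𝒳) (hgen : IsGen 𝒲 𝒳)
    (hproj : ∀ W ∈ 𝒲, ∀ X ∈ 𝒳, ∀ i : ℕ, 1 ≤ i → ∀ e : Abelian.Ext W X i, e = 0) (m : ℕ) :
    ∀ C : A, HasCoresLE 𝒳 m C →
      (∀ W ∈ 𝒲, ∀ i : ℕ, 1 ≤ i → ∀ e : Abelian.Ext W C i, e = 0) → C ∈ 𝒳 := by
  induction m with
  | zero => exact fun C hC _ => hC
  | succ m ih =>
    rintro C ⟨X, K, f, g, hx, h, hK⟩ hC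
    have hK' : K ∈ 𝒳 := by
      refine ih K hK fun W hW i hi e => ?_
      obtain ⟨w, h⟩ := h
      obtain ⟨x, rfl⟩ := Abelian.Ext.covariant_sequence_exact₃ W h e rfl
        (hC W hW _ (by omega) _)
      rw [hproj W hW X hx i hi x]
      simp
    obtain ⟨X', W, a, b, hW, hX', hab⟩ := hgen.2 K hK'
    obtain ⟨P, i₁, p₂, i₂, p₁, h1, h2⟩ := ses_pb h hab
    have hP : P ∈ 𝒳 := hX _ _ h2 hX' hx
    obtain ⟨r, s, e1, e2, e3, e4⟩ := ses_split h1 (hC W hW 1 le_rfl)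
    have : Mono s := mono_of_mono_fac e2
    have : Epi r := epi_of_epi_fac e1
    refine hcoker s r (ses_of e3 fun T t ht => ⟨t ≫ p₂, ?_⟩) (hgen.1 hW) hP
    rw [← Category.comp_id t, ← e4]
    simp [reassoc_of% ht, e2, h1.1, reassoc_of% h1.1, reassoc_of% e2]

lemma cores_all [EnoughProjectives A] [CategoryTheory.HasExt.{v} A] {𝒳 𝒲 : Set A}
    (hX : ExtClosed 𝒳) (hcoker : CokerClosed 𝒳)
    (hgen : IsGen 𝒲 𝒳) (hproj : IsXProj 𝒲 𝒳) (n : ℕ) (U : A) :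
    ∀ C : A, CoresWithCokernel 𝒳 n C U → (∃ m, HasCoresLE 𝒳 m C) →
      ∃ (C' : A) (m : ℕ), Nonempty (C' ≅ U) ∧ HasCoresLE 𝒳 m C' := by
  induction n with
  | zero =>
    rintro C h ⟨m, hm⟩
    exact ⟨C, m, h, hm⟩
  | succ n ih =>
    rintro C ⟨X, K, f, g, hx, h, hK⟩ ⟨m, hm⟩
    exact ih K hK (cores_step hX hcoker hgen hproj m h hx hm)

lemma mem_zero {𝒳 𝒲 : Set A} (hcoker : CokerClosed 𝒳) {X : A} (hx : X ∈ 𝒳) {Z : A}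
    (hZ : IsZero Z) : Z ∈ 𝒳 := by
  have : Epi (0 : X ⟶ Z) := ⟨fun _ _ _ => hZ.eq_of_src _ _⟩
  exact hcoker (𝟙 X) (0 : X ⟶ Z) (ses_of (by simp) fun T t _ => ⟨t, by simp⟩) hx hx

open ZeroObject in
lemma mem_iso {𝒳 : Set A} (hX : ExtClosed 𝒳) (hcoker : CokerClosed 𝒳) {X Y : A} (e : X ≅ Y)
    (hx : X ∈ 𝒳) : Y ∈ 𝒳 := by
  have h0 := mem_zero (𝒲 := 𝒳) hcoker hx (isZero_zero A)
  refine hcoker (0 : 0 ⟶ X) e.hom ?_ h0 hx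
  have : Mono (0 : (0 : A) ⟶ X) := ⟨fun _ _ _ => (isZero_zero A).eq_of_tgt _ _⟩
  refine ses_of (by simp) fun T t ht => ⟨0, ?_⟩
  rw [← cancel_mono e.hom, ht]; simp

theorem stmt19 [EnoughProjectives A] [EnoughInjectives A]
    (𝒳 𝒲 : Set A) (hX : ExtClosed 𝒳) (hcoker : CokerClosed 𝒳)
    (hgen : IsGen 𝒲 𝒳) (hproj : IsXProj 𝒲 𝒳)
    (n : ℕ) (C U : A) (hseq : CoresWithCokernel 𝒳 n C U)
    (hfin : ∃ m, HasCoresLE 𝒳 m C)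
    (hvan : ∀ W ∈ 𝒲, ∀ i : ℕ, 1 ≤ i → ExtVanish i W U) :
    U ∈ 𝒳 := by
  have : CategoryTheory.HasExt.{v} A := hasExt_of_enoughProjectives.{v} A
  obtain ⟨C', m, ⟨e⟩, hm⟩ := cores_all hX hcoker hgen hproj n U C hseq hfin
  refine mem_iso hX hcoker e (mem_of_cores hX hcoker hgen
    (fun W hW X hx i hi => ext_sub hi (hproj W hW X hx i hi)) m C' hm ?_)
  intro W hW i hi
  exact ext_sub hi (IsZero.of_iso (hvan W hW i hi) (((Ext ℤ A i).obj (op W)).mapIso e))
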